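/- arXiv:2111.12018 — 3 statements merged into one kernel-verified Lean document; each statement's English description precedes it below -/
import Mathlib

section
/- (Collinear projections force coplanarity) Let P ∈ ℝ³, n ∈ ℝ³ nonzero, d ∈ ℝ with ⟪P,n⟫ ≠ d, and Π = {w ∈ ℝ³ : ⟪w,n⟫ = d}. Let a, b, c ∈ ℝ³ satisfy ⟪x − P, n⟫ ≠ 0 for each x ∈ {a,b,c}, and suppose the central projections π_P(a), π_P(b), π_P(c) onto Π are collinear. Then the four points P, a, b, c lie in a common affine plane of ℝ³. -/
open Real RealInnerProductSpace

/-- Central projection from `P` onto the plane `{w | ⟪w, n⟫ = d}`: the unique point of the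
plane lying on the line through `P` and `x` (when `⟪x - P, n⟫ ≠ 0`). -/
noncomputable def centralProj (P n : EuclideanSpace ℝ (Fin 3)) (d : ℝ)
    (x : EuclideanSpace ℝ (Fin 3)) : EuclideanSpace ℝ (Fin 3) :=
  P + ((d - ⟪P, n⟫) / ⟪x - P, n⟫) • (x - P)

/-- An affine subspace containing `P` and the central projection of `x` from `P` contains `x`. -/
theorem mem_of_centralProj_mem {P n : EuclideanSpace ℝ (Fin 3)} {d : ℝ}
    (hP : ⟪P, n⟫ ≠ d) {x : EuclideanSpace ℝ (Fin 3)} (hx : ⟪x - P, n⟫ ≠ 0)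
    {s : AffineSubspace ℝ (EuclideanSpace ℝ (Fin 3))} (hPs : P ∈ s)
    (hxs : centralProj P n d x ∈ s) : x ∈ s := by
  have hk : (d - ⟪P, n⟫) / ⟪x - P, n⟫ ≠ 0 := div_ne_zero (sub_ne_zero.2 hP.symm) hx
  have h := AffineMap.lineMap_mem ((d - ⟪P, n⟫) / ⟪x - P, n⟫)⁻¹ hPs hxs
  rwa [AffineMap.lineMap_apply, centralProj, vsub_eq_sub, add_sub_cancel_left,
    inv_smul_smul₀ hk, vadd_eq_add, sub_add_cancel] at h

theorem stmt_15 (P n : EuclideanSpace ℝ (Fin 3)) (hn : n ≠ 0) (d : ℝ) (hP : ⟪P, n⟫ ≠ d)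
    (a b c : EuclideanSpace ℝ (Fin 3))
    (ha : ⟪a - P, n⟫ ≠ 0) (hb : ⟪b - P, n⟫ ≠ 0) (hc : ⟪c - P, n⟫ ≠ 0)
    (hcol : Collinear ℝ {centralProj P n d a, centralProj P n d b, centralProj P n d c}) :
    Coplanar ℝ {P, a, b, c} := by
  have h := hcol.coplanar_insert P
  rw [Coplanar, ← direction_affineSpan] at h ⊢
  refine (Submodule.rank_mono (AffineSubspace.direction_le (affineSpan_le.2 ?_))).trans h
  have hsub := subset_affineSpan ℝ
    {P, centralProj P n d a, centralProj P n d b, centralProj P n d c}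
  have hPs := hsub (Set.mem_insert P _)
  rintro x (rfl | rfl | rfl | rfl)
  · exact hPs
  · exact mem_of_centralProj_mem hP ha hPs (hsub (by simp))
  · exact mem_of_centralProj_mem hP hb hPs (hsub (by simp))
  · exact mem_of_centralProj_mem hP hc hPs (hsub (by simp))
end

section
/- (Barrel distortions of vertical features are inevitable for the spherical projection) Let φ ∈ ℝ and let Π_φ = {(r·cos φ, r·sin φ, z) : r, z ∈ ℝ} be the plane through the z-axis of azimuth φ. For every point P ∈ ℝ³ with P ∉ Π_φ, there exist three points a, b, c on the meridian M_φ = {(sin θ·cos φ, sin θ·sin φ, cos θ) : θ ∈ (0, π)} such that P, a, b, c do not lie in a common affine plane of ℝ³ (hence, by the coplanarity criterion, their central projections from P onto any image plane, when defined, are not collinear, so the vertical feature appears curved). -/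
open Real

noncomputable def v3 (x y z : ℝ) : EuclideanSpace ℝ (Fin 3) :=
  (WithLp.equiv 2 (Fin 3 → ℝ)).symm ![x, y, z]

/-- The meridian of azimuth φ on the unit sphere. -/
def meridian (φ : ℝ) : Set (EuclideanSpace ℝ (Fin 3)) :=
  {v | ∃ θ ∈ Set.Ioo (0 : ℝ) π, v = v3 (sin θ * cos φ) (sin θ * sin φ) (cos θ)}

theorem not_coplanar_of_linearIndependent {V : Type*} [AddCommGroup V] [Module ℝ V]
    {s : Set V} {v : Fin 3 → V} (hv : LinearIndependent ℝ v)
    (hs : ∀ i, v i ∈ vectorSpan ℝ s) : ¬ Coplanar ℝ s := by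
  intro h
  have hle : Submodule.span ℝ (Set.range v) ≤ vectorSpan ℝ s := by
    rw [Submodule.span_le]
    rintro _ ⟨i, rfl⟩
    exact hs i
  have := h.finiteDimensional_vectorSpan
  have hle' := (Submodule.finrank_mono hle).trans h.finrank_le_two
  rw [finrank_span_eq_card hv, Fintype.card_fin] at hle'
  omega

theorem exists_eq_v3_of_cross_eq_zero (φ : ℝ) (P : EuclideanSpace ℝ (Fin 3))
    (h : P 1 * cos φ - P 0 * sin φ = 0) :
    ∃ r z : ℝ, P = v3 (r * cos φ) (r * sin φ) z := by
  refine ⟨P 0 * cos φ + P 1 * sin φ, P 2, ?_⟩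
  have hφ := sin_sq_add_cos_sq φ
  ext i
  fin_cases i
  · simp [v3]
    linear_combination -P 0 * hφ - sin φ * h
  · simp [v3]
    linear_combination -P 1 * hφ + cos φ * h
  · simp [v3]

theorem stmt_16 (φ : ℝ) (P : EuclideanSpace ℝ (Fin 3))
    (hP : P ∉ {v : EuclideanSpace ℝ (Fin 3) | ∃ r z : ℝ, v = v3 (r * cos φ) (r * sin φ) z}) :
    ∃ a ∈ meridian φ, ∃ b ∈ meridian φ, ∃ c ∈ meridian φ,
      ¬ Coplanar ℝ {P, a, b, c} := by
  have hk : P 1 * cos φ - P 0 * sin φ ≠ 0 := fun h => hP (exists_eq_v3_of_cross_eq_zero φ P h)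
  have hπ := pi_pos
  have hφ := sin_sq_add_cos_sq φ
  have hs : sin (π - π / 3) = √3 / 2 := by rw [sin_pi_sub, sin_pi_div_three]
  have hc : cos (π - π / 3) = -(1 / 2) := by rw [cos_pi_sub, cos_pi_div_three]
  have h3 : 1 - √3 / 2 ≠ 0 := by
    have : √3 < 2 := by rw [sqrt_lt' (by norm_num)]; norm_num
    linarith
  refine ⟨_, ⟨π / 3, ⟨by linarith, by linarith⟩, rfl⟩,
    _, ⟨π / 2, ⟨by linarith, by linarith⟩, rfl⟩,
    _, ⟨π - π / 3, ⟨by linarith, by linarith⟩, rfl⟩, ?_⟩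
  rw [hs, hc, sin_pi_div_three, cos_pi_div_three, sin_pi_div_two, cos_pi_div_two]
  set a := v3 (√3 / 2 * cos φ) (√3 / 2 * sin φ) (1 / 2) with ha
  set b := v3 (1 * cos φ) (1 * sin φ) 0 with hb
  set c := v3 (√3 / 2 * cos φ) (√3 / 2 * sin φ) (-(1 / 2)) with hc'
  refine not_coplanar_of_linearIndependent (v := ![a - c, b - a, P - b]) ?_ ?_
  · rw [Fintype.linearIndependent_iff]
    intro g hg
    have e0 := congrArg (fun v : EuclideanSpace ℝ (Fin 3) => v 0) hg
    have e1 := congrArg (fun v : EuclideanSpace ℝ (Fin 3) => v 1) hg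
    have e2 := congrArg (fun v : EuclideanSpace ℝ (Fin 3) => v 2) hg
    simp [Fin.sum_univ_three, ha, hb, hc', v3] at e0 e1 e2
    have g2 : g 2 = 0 := by
      refine (mul_eq_zero.mp ?_).resolve_right hk
      linear_combination cos φ * e1 - sin φ * e0
    rw [g2] at e0 e1 e2
    have g1 : g 1 = 0 := by
      refine (mul_eq_zero.mp ?_).resolve_right h3
      linear_combination cos φ * e0 + sin φ * e1 - g 1 * (1 - √3 / 2) * hφ
    rw [g1] at e2
    have g0 : g 0 = 0 := by linarith
    intro i
    fin_cases i <;> assumption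
  · intro i
    fin_cases i <;> exact vsub_mem_vectorSpan ℝ (by simp) (by simp)
end

section
/- (Lemma 1, full composition) Let (a,b) ∈ ℝ² with a² + b² > 0 and let L = {(a,b,z) : z ∈ ℝ} be a vertical line in the scene. Let P ∈ ℝ³ be a camera position with p_x² + p_y² < 1, and let Π = {w ∈ ℝ³ : ⟪w,n⟫ = d} be an image plane with ⟪P,n⟫ ≠ d. Then the set of central projections from P onto Π of the points ρ(q), q ∈ L, for which the projection is defined, is contained in a single affine line of Π. That is, re-projecting the panorama onto the unit cylinder and rendering perspectively from the off-center position P draws the vertical scene feature L as a straight 2D line. -/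
open Real RealInnerProductSpace

/-- The radial cylinder projection ρ(x,y,z) = (x,y,z)/√(x²+y²). -/
noncomputable def radialCylProj (v : EuclideanSpace ℝ (Fin 3)) : EuclideanSpace ℝ (Fin 3) :=
  (Real.sqrt ((v 0) ^ 2 + (v 1) ^ 2))⁻¹ • v

theorem collinear_centralProj_line (P n x e : EuclideanSpace ℝ (Fin 3)) (d : ℝ) :
    Collinear ℝ {w | ∃ t : ℝ, ⟪x + t • e - P, n⟫ ≠ 0 ∧ w = centralProj P n d (x + t • e)} := by
  have hinner (t : ℝ) : ⟪x + t • e - P, n⟫ = ⟪x - P, n⟫ + t * ⟪e, n⟫ := by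
    rw [add_sub_right_comm, inner_add_left, real_inner_smul_left]
  simp only [centralProj, hinner]
  generalize ⟪e, n⟫ = β
  generalize d - ⟪P, n⟫ = k
  generalize ⟪x - P, n⟫ = α
  rw [collinear_iff_exists_forall_eq_smul_vadd]
  by_cases hα : α = 0
  · subst hα
    refine ⟨P + (k / β) • e, x - P, ?_⟩
    rintro _ ⟨t, ht, rfl⟩
    rw [zero_add] at ht ⊢
    obtain ⟨ht0, hβ⟩ := mul_ne_zero_iff.mp ht
    refine ⟨k / (t * β), ?_⟩
    rw [vadd_eq_add]
    match_scalars <;> field_simp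
    ring
  · refine ⟨P + (k / α) • (x - P), α • e - β • (x - P), ?_⟩
    rintro _ ⟨t, ht, rfl⟩
    refine ⟨k * t / (α * (α + t * β)), ?_⟩
    rw [vadd_eq_add]
    match_scalars <;> field_simp <;> ring

theorem radialCylProj_v3 (a b z : ℝ) :
    radialCylProj (v3 a b z) =
      (√(a ^ 2 + b ^ 2))⁻¹ • v3 a b 0 + ((√(a ^ 2 + b ^ 2))⁻¹ * z) • v3 0 0 1 := by
  ext i
  fin_cases i <;> simp [radialCylProj, v3]

theorem stmt_17 (a b : ℝ) (hab : a ^ 2 + b ^ 2 > 0)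
    (P n : EuclideanSpace ℝ (Fin 3)) (hn : n ≠ 0)
    (hPin : (P 0) ^ 2 + (P 1) ^ 2 < 1) (d : ℝ) (hP : ⟪P, n⟫ ≠ d) :
    Collinear ℝ
      {w | ∃ q ∈ {v : EuclideanSpace ℝ (Fin 3) | ∃ z : ℝ, v = v3 a b z},
        ⟪radialCylProj q - P, n⟫ ≠ 0 ∧ w = centralProj P n d (radialCylProj q)} := by
  refine (collinear_centralProj_line P n ((√(a ^ 2 + b ^ 2))⁻¹ • v3 a b 0) (v3 0 0 1) d).subset ?_
  rintro w ⟨_, ⟨z, rfl⟩, hne, rfl⟩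
  rw [radialCylProj_v3] at hne ⊢
  exact ⟨_, hne, rfl⟩
end
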